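/- Let the peeling sequence H₀ ⊋ H₁ ⊋ ⋯ ⊋ H_{n−1} be obtained by repeatedly removing a minimum-weighted-degree vertex, and let H* be an optimal set for σ. At the first step i where some vertex of H* is removed from H_i, the removed vertex v satisfies deg_w(v, H_i) ≥ deg_w(v, H*) ≥ σ(H*). -/

import Mathlib

open Finset

/-- Total weight of (unordered) pairs inside `H`, for a symmetric pair-weight `w`. -/
noncomputable def totalWeight {V : Type*} [DecidableEq V] (w : V → V → ℝ) (H : Finset V) : ℝ :=
  (∑ u ∈ H, ∑ v ∈ H \ {u}, w u v) / 2

/-- Weighted degree of `v` within `H`. -/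
noncomputable def degW {V : Type*} [DecidableEq V] (w : V → V → ℝ) (v : V) (H : Finset V) : ℝ :=
  ∑ u ∈ H \ {v}, w v u

/-- Average weight σ(H) = w(H)/|H|. -/
noncomputable def avgW {V : Type*} [DecidableEq V] (w : V → V → ℝ) (H : Finset V) : ℝ :=
  totalWeight w H / H.card

theorem degW_mono {V : Type*} [DecidableEq V] {w : V → V → ℝ} (hnn : ∀ u v, 0 ≤ w u v)
    (v : V) {A B : Finset V} (h : A ⊆ B) : degW w v A ≤ degW w v B :=
  Finset.sum_le_sum_of_subset_of_nonneg (Finset.sdiff_subset_sdiff h le_rfl)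
    fun u _ _ => hnn v u

theorem totalWeight_insert {V : Type*} [DecidableEq V] {w : V → V → ℝ}
    (hsymm : ∀ u v, w u v = w v u) {v : V} {S : Finset V} (hv : v ∉ S) :
    totalWeight w (insert v S) = totalWeight w S + degW w v (insert v S) := by
  have hrow : ∀ u ∈ S, ∑ x ∈ insert v S \ {u}, w u x = w v u + ∑ x ∈ S \ {u}, w u x := by
    intro u hu
    have hvu : v ∉ ({u} : Finset V) := by
      rw [Finset.mem_singleton]
      rintro rfl
      exact hv hu
    rw [Finset.insert_sdiff_of_notMem _ hvu, Finset.sum_insert (by simp [hv]), hsymm u v]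
  have hself : insert v S \ {v} = S := by
    rw [Finset.sdiff_singleton_eq_erase, Finset.erase_insert hv]
  unfold totalWeight degW
  rw [Finset.sum_insert hv, Finset.sum_congr rfl hrow, Finset.sum_add_distrib, hself]
  ring

theorem avgW_le_degW_of_optimal {V : Type*} [DecidableEq V] {w : V → V → ℝ}
    (hsymm : ∀ u v, w u v = w v u) {A : Finset V}
    (hopt : ∀ H : Finset V, H.Nonempty → avgW w H ≤ avgW w A) {v : V} (hv : v ∈ A) :
    avgW w A ≤ degW w v A := by
  have hsplit := totalWeight_insert hsymm (Finset.notMem_erase v A)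
  rw [Finset.insert_erase hv] at hsplit
  have hA : (0 : ℝ) < A.card := by exact_mod_cast Finset.card_pos.mpr ⟨v, hv⟩
  have htotal : totalWeight w A = avgW w A * A.card := (div_mul_cancel₀ _ hA.ne').symm
  have hcard : ((A.erase v).card : ℝ) + 1 = A.card := by
    exact_mod_cast Finset.card_erase_add_one hv
  have herase : totalWeight w (A.erase v) ≤ avgW w A * (A.erase v).card := by
    rcases (A.erase v).eq_empty_or_nonempty with h | h
    · simp [h, totalWeight]
    · have hpos : (0 : ℝ) < (A.erase v).card := by exact_mod_cast Finset.card_pos.mpr h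
      exact (div_le_iff₀ hpos).mp (hopt _ h)
  rw [← hcard] at htotal
  linarith

theorem stmt_11 {V : Type*} [Fintype V] [DecidableEq V] (w : V → V → ℝ)
    (hsymm : ∀ u v, w u v = w v u) (hnn : ∀ u v, 0 ≤ w u v)
    (f : ℕ → Finset V) (hf0 : f 0 = Finset.univ)
    (Hstar : Finset V) (hne : Hstar.Nonempty)
    (hopt : ∀ H : Finset V, H.Nonempty → avgW w H ≤ avgW w Hstar)
    (i : ℕ) (hsub : Hstar ⊆ f i) (v : V) (hvstar : v ∈ Hstar)
    (hmin : ∀ u ∈ f i, degW w v (f i) ≤ degW w u (f i))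
    (hremove : f (i + 1) = (f i).erase v) :
    degW w v (f i) ≥ degW w v Hstar ∧ degW w v Hstar ≥ avgW w Hstar :=
  ⟨degW_mono hnn v hsub, avgW_le_degW_of_optimal hsymm hopt hvstar⟩
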